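/- Let S be an inverse subsemigroup of FI₁ and let S̄ be the inverse subsemigroup of S generated by all non-idempotent elements of S (taken to be empty if S has no non-idempotent elements). Then S̄ is an ideal of S: for all x ∈ S and y ∈ S̄, both x·y ∈ S̄ and y·x ∈ S̄. -/

import Mathlib

/-- Multiplication on triples modeling the monogenic free inverse semigroup:
the triple `(a, p, b)` encodes the element written `(-a, p, b)` in the paper. -/
def FI1mul (u v : ℤ × ℤ × ℤ) : ℤ × ℤ × ℤ :=
  (max u.1 (v.1 - u.2.1), u.2.1 + v.2.1, max u.2.2 (v.2.2 + u.2.1))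

/-- Inversion on triples: `(a, p, b)⁻¹ = (a + p, -p, b - p)`. -/
def FI1inv (u : ℤ × ℤ × ℤ) : ℤ × ℤ × ℤ :=
  (u.1 + u.2.1, -u.2.1, u.2.2 - u.2.1)

/-- The monogenic free inverse semigroup in its concrete triple model:
triples `(a, p, b)` with `a, b ∈ ℕ`, `a + b > 0` and `-a ≤ p ≤ b`. -/
def FI1 : Set (ℤ × ℤ × ℤ) :=
  {u | 0 ≤ u.1 ∧ 0 ≤ u.2.2 ∧ 0 < u.1 + u.2.2 ∧ -u.1 ≤ u.2.1 ∧ u.2.1 ≤ u.2.2}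

/-- Membership in the smallest subset containing `X` that is closed under
multiplication and inversion. -/
inductive FI1genMem (X : Set (ℤ × ℤ × ℤ)) : ℤ × ℤ × ℤ → Prop
  | base {u : ℤ × ℤ × ℤ} : u ∈ X → FI1genMem X u
  | mul {u v : ℤ × ℤ × ℤ} : FI1genMem X u → FI1genMem X v → FI1genMem X (FI1mul u v)
  | inv {u : ℤ × ℤ × ℤ} : FI1genMem X u → FI1genMem X (FI1inv u)

/-- `⟨X⟩`: the smallest subset containing `X` closed under multiplication and inversion. -/
def FI1gen (X : Set (ℤ × ℤ × ℤ)) : Set (ℤ × ℤ × ℤ) := {u | FI1genMem X u}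

/-- A (nonempty) inverse subsemigroup of `FI₁`. -/
def IsInvSub (S : Set (ℤ × ℤ × ℤ)) : Prop :=
  S.Nonempty ∧ S ⊆ FI1 ∧ (∀ u ∈ S, ∀ v ∈ S, FI1mul u v ∈ S) ∧ ∀ u ∈ S, FI1inv u ∈ S

theorem FI1mul_self_iff (u : ℤ × ℤ × ℤ) : FI1mul u u = u ↔ u.2.1 = 0 := by
  obtain ⟨a, p, b⟩ := u
  simp only [FI1mul, Prod.mk.injEq]
  omega

theorem FI1mul_assoc (u v w : ℤ × ℤ × ℤ) :
    FI1mul (FI1mul u v) w = FI1mul u (FI1mul v w) := by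
  simp only [FI1mul, Prod.mk.injEq]
  omega

theorem FI1inv_FI1mul (u v : ℤ × ℤ × ℤ) :
    FI1inv (FI1mul u v) = FI1mul (FI1inv v) (FI1inv u) := by
  simp only [FI1mul, FI1inv, Prod.mk.injEq]
  omega

theorem FI1inv_eq_self {e : ℤ × ℤ × ℤ} (he : e.2.1 = 0) : FI1inv e = e := by
  obtain ⟨a, p, b⟩ := e
  simp only [FI1inv, Prod.mk.injEq] at he ⊢
  omega

/-- Multiplication by an idempotent of `S` preserves the inverse subsemigroup generated by the
non-idempotent elements of `S`. -/
theorem FI1genMem.idempotent_mul {S : Set (ℤ × ℤ × ℤ)}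
    (hS : ∀ u ∈ S, ∀ v ∈ S, FI1mul u v ∈ S) {e y : ℤ × ℤ × ℤ} (heS : e ∈ S) (he : e.2.1 = 0)
    (hy : FI1genMem {u | u ∈ S ∧ FI1mul u u ≠ u} y) :
    FI1genMem {u | u ∈ S ∧ FI1mul u u ≠ u} (FI1mul e y) ∧
      FI1genMem {u | u ∈ S ∧ FI1mul u u ≠ u} (FI1mul y e) := by
  induction hy with
  | @base u hu =>
    obtain ⟨huS, hu⟩ := hu
    rw [Ne, FI1mul_self_iff] at hu
    refine ⟨.base ⟨hS _ heS _ huS, ?_⟩, .base ⟨hS _ huS _ heS, ?_⟩⟩ <;>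
      · rw [Ne, FI1mul_self_iff]
        simpa [FI1mul, he] using hu
  | @mul u v hu hv ihu ihv =>
    exact ⟨FI1mul_assoc e u v ▸ ihu.1.mul hv, (FI1mul_assoc u v e).symm ▸ hu.mul ihv.2⟩
  | @inv u hu ih =>
    have hl := ih.2.inv
    have hr := ih.1.inv
    rw [FI1inv_FI1mul, FI1inv_eq_self he] at hl hr
    exact ⟨hl, hr⟩

theorem stmt_16 (S : Set (ℤ × ℤ × ℤ)) (hS : IsInvSub S) :
    ∀ x ∈ S, ∀ y ∈ FI1gen {u | u ∈ S ∧ FI1mul u u ≠ u},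
      FI1mul x y ∈ FI1gen {u | u ∈ S ∧ FI1mul u u ≠ u} ∧
      FI1mul y x ∈ FI1gen {u | u ∈ S ∧ FI1mul u u ≠ u} := by
  intro x hx y hy
  by_cases hxx : FI1mul x x = x
  · exact FI1genMem.idempotent_mul hS.2.2.1 hx ((FI1mul_self_iff x).1 hxx) hy
  · have hx' : FI1genMem {u | u ∈ S ∧ FI1mul u u ≠ u} x := .base ⟨hx, hxx⟩
    exact ⟨hx'.mul hy, FI1genMem.mul hy hx'⟩
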